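/- arXiv:2405.05436 — 2 statements merged into one kernel-verified Lean document; each statement's English description precedes it below -/
import Mathlib

section
/- For every n ≥ 2, sup_{x∈[0,1]} |p_n(x)| ≤ 2 · exp( n · max_{1≤j≤n−1} s_n(j)/H_n(j) ) · |p_n(a_n)|, where s_n and H_n are computed from the first n points a₀, …, a_{n−1} listed in increasing order ζ_{n1} < ⋯ < ζ_{nn}. -/
open Filter

/-- `p_n(x) = ∏_{j=0}^{n-1} (x - a_j)`. -/
noncomputable def lejaPoly (a : ℕ → ℝ) (n : ℕ) (x : ℝ) : ℝ :=
  ∏ j ∈ Finset.range n, (x - a j)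

/-- The candidate set `M_n`: midpoints `(x+y)/2` of pairs `x < y` of points among
`a₀, …, a_{n-1}` with no `a_l` (`l < n`) strictly between them. -/
def midCandidates (a : ℕ → ℝ) (n : ℕ) : Set ℝ :=
  {m | ∃ i j, i < n ∧ j < n ∧ a i < a j ∧
    (∀ l, l < n → ¬(a i < a l ∧ a l < a j)) ∧ m = (a i + a j) / 2}

/-- Half-gap `s_n(j) = (ζ_{nj} + ζ_{n(j+1)})/2 - ζ_{nj}` of the sorted row. -/
noncomputable def sgap (ζ : ℕ → ℕ → ℝ) (n j : ℕ) : ℝ :=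
  (ζ n j + ζ n (j + 1)) / 2 - ζ n j

/-- `H_n(j) = ((1/n) ∑_{k=1}^n 1/|m_{nj} - ζ_{nk}|)⁻¹` for the sorted row. -/
noncomputable def Hfun (ζ : ℕ → ℕ → ℝ) (n j : ℕ) : ℝ :=
  ((1 / (n : ℝ)) * ∑ k ∈ Finset.Icc 1 n,
      1 / |(ζ n j + ζ n (j + 1)) / 2 - ζ n k|)⁻¹

/-- A term of a finite supremum of reals is bounded by the bounded supremum. -/
theorem Finset.le_biSup_real (s : Finset ℕ) (f : ℕ → ℝ) {j : ℕ} (hj : j ∈ s) :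
    f j ≤ ⨆ i ∈ s, f i := by
  have hb : BddAbove (Set.range fun i => ⨆ _ : i ∈ s, f i) := by
    refine ⟨∑ i ∈ s, |f i|, ?_⟩
    rintro _ ⟨i, rfl⟩
    by_cases hi : i ∈ s
    · simp only [hi, ciSup_unique]
      exact (le_abs_self _).trans
        (Finset.single_le_sum (f := fun i => |f i|) (fun _ _ => abs_nonneg _) hi)
    · simp only [hi, Real.iSup_of_isEmpty]
      exact Finset.sum_nonneg fun _ _ => abs_nonneg _
  simpa only [hj, ciSup_unique] using le_ciSup hb j

/-- Moving from `m` to a point at distance at most `s` changes a product of distances by at most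
the exponential of `s` times the sum of the inverse distances. -/
theorem prod_abs_sub_le_exp_mul {ι : Type*} (t : Finset ι) (z : ι → ℝ) {x m s : ℝ}
    (hxm : |x - m| ≤ s) (hm : ∀ i ∈ t, m ≠ z i) :
    ∏ i ∈ t, |x - z i| ≤ Real.exp (s * ∑ i ∈ t, 1 / |m - z i|) * ∏ i ∈ t, |m - z i| := by
  rw [Finset.mul_sum, Real.exp_sum, ← Finset.prod_mul_distrib]
  refine Finset.prod_le_prod (fun _ _ => abs_nonneg _) fun i hi => ?_
  have hpos : 0 < |m - z i| := abs_pos.2 (sub_ne_zero.2 (hm i hi))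
  calc |x - z i| ≤ |x - m| + |m - z i| := abs_sub_le _ _ _
    _ ≤ s + |m - z i| := by gcongr
    _ = (s * (1 / |m - z i|) + 1) * |m - z i| := by field_simp
    _ ≤ Real.exp (s * (1 / |m - z i|)) * |m - z i| := by
      gcongr
      exact Real.add_one_le_exp _

/-- A point that is at least one value and smaller than another value of an increasing finite
sequence lies between two consecutive values. -/
theorem exists_consecutive_le_lt {n : ℕ} {z : ℕ → ℝ} {x : ℝ}
    (hz : ∀ j k, 1 ≤ j → j < k → k ≤ n → z j < z k)
    (hlo : ∃ k ∈ Finset.Icc 1 n, z k ≤ x) (hhi : ∃ k ∈ Finset.Icc 1 n, x < z k) :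
    ∃ j, 1 ≤ j ∧ j + 1 ≤ n ∧ z j ≤ x ∧ x < z (j + 1) := by
  obtain ⟨k, hk, hkx⟩ := hlo
  obtain ⟨l, hl, hlx⟩ := hhi
  obtain ⟨j, hj, hmax⟩ := ((Finset.Icc 1 n).filter (z · ≤ x)).exists_max_image id
    ⟨k, Finset.mem_filter.2 ⟨hk, hkx⟩⟩
  simp only [Finset.mem_filter, Finset.mem_Icc, id] at hj hmax hl
  have hjl : j < l := by
    by_contra! h
    rcases h.eq_or_lt with rfl | h
    · linarith
    · linarith [hz l j hl.1 h hj.1.2]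
  refine ⟨j, hj.1.1, by omega, hj.2, ?_⟩
  by_contra! h
  have := hmax (j + 1) ⟨⟨by omega, by omega⟩, h⟩
  omega


/-- For fast Leja points `(a_j)` on `[0,1]` with midpoint
candidates, for every `n ≥ 2`,
`sup_{x ∈ [0,1]} |p_n(x)| ≤ 2 exp(n · max_{1 ≤ j ≤ n-1} s_n(j)/H_n(j)) · |p_n(a_n)|`,
where `s_n, H_n` come from the first `n` points sorted increasingly as
`ζ_{n1} < ⋯ < ζ_{nn}`. -/
theorem stmt_9
    (a : ℕ → ℝ)
    (hmem : ∀ j, a j ∈ Set.Icc (0 : ℝ) 1)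
    (hinj : Function.Injective a)
    (ha0 : a 0 = 0) (ha1 : a 1 = 1)
    (hleja : ∀ n, 2 ≤ n → a n ∈ midCandidates a n ∧
      ∀ m ∈ midCandidates a n, |lejaPoly a n m| ≤ |lejaPoly a n (a n)|)
    (ζ : ℕ → ℕ → ℝ)
    (hζmono : ∀ n, 2 ≤ n → ∀ j k, 1 ≤ j → j < k → k ≤ n → ζ n j < ζ n k)
    (hζimage : ∀ n, 2 ≤ n →
      (Finset.Icc 1 n).image (ζ n) = (Finset.range n).image a) :
    ∀ n, 2 ≤ n → ∀ x ∈ Set.Icc (0 : ℝ) 1,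
      |lejaPoly a n x| ≤
        2 * Real.exp ((n : ℝ) * ⨆ j ∈ Finset.Icc 1 (n - 1), sgap ζ n j / Hfun ζ n j) *
          |lejaPoly a n (a n)| := by
  intro n hn x hx
  have hz := hζmono n hn
  have himg := hζimage n hn
  have hpoly (y : ℝ) : |lejaPoly a n y| = ∏ k ∈ Finset.Icc 1 n, |y - ζ n k| := by
    have hinjζ : Set.InjOn (ζ n) (Finset.Icc 1 n) := by
      intro j hj k hk h
      simp only [Finset.coe_Icc, Set.mem_Icc] at hj hk
      rcases lt_trichotomy j k with hlt | heq | hlt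
      · exact absurd h (hz j k hj.1 hlt hk.2).ne
      · exact heq
      · exact absurd h (hz k j hk.1 hlt hj.2).ne'
    rw [lejaPoly, Finset.abs_prod, ← Finset.prod_image (g := a) (f := fun w => |y - w|) hinj.injOn,
      ← himg, Finset.prod_image hinjζ]
  have hval (i : ℕ) (hi : i < n) : ∃ k ∈ Finset.Icc 1 n, ζ n k = a i := by
    rw [← Finset.mem_image, himg]
    exact Finset.mem_image_of_mem a (Finset.mem_range.2 hi)
  have hidx (k : ℕ) (hk : 1 ≤ k ∧ k ≤ n) : ∃ i < n, a i = ζ n k := by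
    have h := Finset.mem_image_of_mem (ζ n) (Finset.mem_Icc.2 hk)
    rw [himg] at h
    simpa using h
  rcases hx.2.eq_or_lt with rfl | hx1
  · have h0 : lejaPoly a n 1 = 0 :=
      Finset.prod_eq_zero (Finset.mem_range.2 (show 1 < n by omega)) (by simp [ha1])
    rw [h0, abs_zero]
    positivity
  obtain ⟨k, hk, hk0⟩ := hval 0 (by omega)
  obtain ⟨l, hl, hl1⟩ := hval 1 (by omega)
  obtain ⟨j, hj1, hjn, hjx, hxj⟩ := exists_consecutive_le_lt (x := x) hz
    ⟨k, hk, by rw [hk0, ha0]; exact hx.1⟩ ⟨l, hl, by rw [hl1, ha1]; exact hx1⟩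
  have hgap := hz j (j + 1) hj1 (by omega) hjn
  have hbetween (k : ℕ) (hk : 1 ≤ k ∧ k ≤ n) : ¬(ζ n j < ζ n k ∧ ζ n k < ζ n (j + 1)) := by
    rintro ⟨h1, h2⟩
    rcases lt_trichotomy k j with h | rfl | h
    · linarith [hz k j hk.1 h (by omega)]
    · linarith
    · rcases (Nat.succ_le_of_lt h).eq_or_lt with h | h
      · subst h
        exact lt_irrefl _ h2
      · linarith [hz (j + 1) k (by omega) h hk.2]
  set m := (ζ n j + ζ n (j + 1)) / 2 with hm
  have hmem_cand : m ∈ midCandidates a n := by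
    obtain ⟨i, hi, hia⟩ := hidx j ⟨hj1, by omega⟩
    obtain ⟨i', hi', hia'⟩ := hidx (j + 1) ⟨by omega, hjn⟩
    refine ⟨i, i', hi, hi', by rwa [hia, hia'], fun q hq => ?_, by rw [hia, hia']⟩
    obtain ⟨k, hk, hkq⟩ := hval q hq
    rw [hia, hia', ← hkq]
    exact hbetween k (Finset.mem_Icc.1 hk)
  have hmne (k : ℕ) (hk : k ∈ Finset.Icc 1 n) : m ≠ ζ n k := fun h =>
    hbetween k (Finset.mem_Icc.1 hk) ⟨by linarith, by linarith⟩
  have hxm : |x - m| ≤ sgap ζ n j := by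
    rw [sgap, ← hm, abs_le]
    constructor <;> linarith
  have hn0 : (n : ℝ) ≠ 0 := by positivity
  have hexp : sgap ζ n j * ∑ k ∈ Finset.Icc 1 n, 1 / |m - ζ n k| =
      n * (sgap ζ n j / Hfun ζ n j) := by
    rw [Hfun, ← hm, div_inv_eq_mul]
    field_simp
  have hsup := Finset.le_biSup_real (Finset.Icc 1 (n - 1))
    (fun j => sgap ζ n j / Hfun ζ n j) (Finset.mem_Icc.2 ⟨hj1, by omega⟩)
  have hmain := prod_abs_sub_le_exp_mul (Finset.Icc 1 n) (ζ n) hxm hmne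
  rw [← hpoly, ← hpoly, hexp] at hmain
  calc |lejaPoly a n x|
      ≤ Real.exp (n * (sgap ζ n j / Hfun ζ n j)) * |lejaPoly a n m| := hmain
    _ ≤ Real.exp (n * ⨆ j ∈ Finset.Icc 1 (n - 1), sgap ζ n j / Hfun ζ n j) *
          |lejaPoly a n (a n)| := by
      refine mul_le_mul ?_ ((hleja n hn).2 m hmem_cand) (abs_nonneg _) (Real.exp_pos _).le
      gcongr
    _ ≤ _ := by
      gcongr
      linarith [Real.exp_pos ((n : ℝ) * ⨆ j ∈ Finset.Icc 1 (n - 1), sgap ζ n j / Hfun ζ n j)]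
end

section
/- Suppose the sequence (a_j) has Property (★), i.e. max_{1≤j≤n−1} s_n(j)/H_n(j) → 0 as n → ∞. Then the fast Leja points form a pseudo Leja sequence: the ratio (sup_{x∈[0,1]} |p_n(x)|) / |p_n(a_n)| grows subexponentially, i.e. lim_{n→∞} ( (sup_{x∈[0,1]} |p_n(x)|) / |p_n(a_n)| )^{1/n} = 1. -/
open Filter

/-- If `x` is within `s` of `m`, then `∏ |x - z k|` exceeds `∏ |m - z k|` by at most the factor
`exp (s * ∑ 1 / |m - z k|)`. -/
theorem prod_abs_sub_le_mul_exp {ι : Type*} (t : Finset ι) (z : ι → ℝ) {x m s : ℝ}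
    (hx : |x - m| ≤ s) (hm : ∀ k ∈ t, m ≠ z k) :
    ∏ k ∈ t, |x - z k| ≤ (∏ k ∈ t, |m - z k|) * Real.exp (s * ∑ k ∈ t, 1 / |m - z k|) := by
  rw [Finset.mul_sum, Real.exp_sum, ← Finset.prod_mul_distrib]
  refine Finset.prod_le_prod (fun _ _ => abs_nonneg _) fun k hk => ?_
  have hpos : 0 < |m - z k| := abs_pos.2 (sub_ne_zero.2 (hm k hk))
  calc |x - z k| ≤ |x - m| + |m - z k| := abs_sub_le _ _ _
    _ ≤ s + |m - z k| := by gcongr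
    _ = |m - z k| * (s * (1 / |m - z k|) + 1) := by field_simp
    _ ≤ _ := by gcongr; exact Real.add_one_le_exp _

/-- `|p_n|` is the product of the distances to the points of any injective enumeration of
`a₀, …, a_{n-1}`. -/
theorem abs_lejaPoly_eq_prod {a : ℕ → ℝ} (hinj : Function.Injective a) {n : ℕ} {z : ℕ → ℝ}
    (hz : Set.InjOn z (Finset.Icc 1 n))
    (himage : (Finset.Icc 1 n).image z = (Finset.range n).image a) (x : ℝ) :
    |lejaPoly a n x| = ∏ k ∈ Finset.Icc 1 n, |x - z k| := by
  rw [lejaPoly, Finset.abs_prod,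
    ← Finset.prod_image (f := fun y => |x - y|) (g := a) hinj.injOn, ← himage,
    Finset.prod_image hz]

/-- A point between the first and the last term of a finite sequence lies between two
consecutive terms. -/
theorem exists_consecutive_le_le {z : ℕ → ℝ} {n : ℕ} (hn : 2 ≤ n) {x : ℝ}
    (h1 : z 1 ≤ x) (h2 : x ≤ z n) :
    ∃ j ∈ Finset.Icc 1 (n - 1), z j ≤ x ∧ x ≤ z (j + 1) := by
  by_contra! h
  have key : ∀ j, 1 ≤ j → j ≤ n - 1 → z j ≤ x := by
    intro j hj
    induction j, hj using Nat.le_induction with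
    | base => exact fun _ => h1
    | succ j hj ih =>
      intro hjn
      exact (h j (Finset.mem_Icc.2 ⟨hj, by omega⟩) (ih (by omega))).le
  have := h (n - 1) (Finset.mem_Icc.2 ⟨by omega, le_rfl⟩) (key _ (by omega) le_rfl)
  rw [Nat.sub_add_cancel (by omega)] at this
  linarith

/-- A value of a function on a finite set of indices is at most its real-valued supremum. -/
theorem le_biSup_finset {ι : Type*} (t : Finset ι) (f : ι → ℝ) {j : ι} (hj : j ∈ t) :
    f j ≤ ⨆ i ∈ t, f i := by
  have hbdd : BddAbove (Set.range fun i => ⨆ _ : i ∈ t, f i) := by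
    refine ⟨∑ i ∈ t, |f i|, ?_⟩
    rintro _ ⟨i, rfl⟩
    refine Real.iSup_le (fun hi => ?_) (Finset.sum_nonneg fun _ _ => abs_nonneg _)
    exact (le_abs_self _).trans
      (Finset.single_le_sum (f := fun i => |f i|) (fun _ _ => abs_nonneg _) hi)
  have := le_ciSup hbdd j
  simpa only [ciSup_pos hj] using this

/-- If a nonnegative function on `s` is bounded by `B`, each of its values is at most its
supremum over `s`. -/
theorem le_biSup_of_forall_le {s : Set ℝ} {f : ℝ → ℝ} {B : ℝ} (hB : 0 ≤ B)
    (hf : ∀ x ∈ s, f x ≤ B) {x : ℝ} (hx : x ∈ s) : f x ≤ ⨆ y ∈ s, f y := by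
  have hbdd : BddAbove (Set.range fun y => ⨆ _ : y ∈ s, f y) := by
    refine ⟨B, ?_⟩
    rintro _ ⟨y, rfl⟩
    exact Real.iSup_le (hf y) hB
  have := le_ciSup hbdd x
  simpa only [ciSup_pos hx] using this

/-- Midpoints of consecutive points of the sorted row are candidates. -/
theorem midpoint_mem_midCandidates {a : ℕ → ℝ} {n : ℕ} {z : ℕ → ℝ}
    (hz : StrictMonoOn z (Finset.Icc 1 n))
    (himage : (Finset.Icc 1 n).image z = (Finset.range n).image a)
    {j : ℕ} (hj : 1 ≤ j) (hjn : j + 1 ≤ n) :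
    (z j + z (j + 1)) / 2 ∈ midCandidates a n := by
  have hex : ∀ k, 1 ≤ k → k ≤ n → ∃ i < n, a i = z k := fun k hk hkn => by
    have : z k ∈ (Finset.range n).image a :=
      himage ▸ Finset.mem_image_of_mem z (Finset.mem_Icc.2 ⟨hk, hkn⟩)
    simpa using this
  obtain ⟨i, hi, hai⟩ := hex j hj (by omega)
  obtain ⟨i', hi', hai'⟩ := hex (j + 1) (by omega) hjn
  have hmem : ∀ k, 1 ≤ k → k ≤ n → k ∈ (Finset.Icc 1 n : Set ℕ) := fun k h h' => by simp [h, h']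
  refine ⟨i, i', hi, hi', ?_, ?_, by rw [hai, hai']⟩
  · rw [hai, hai']
    exact hz (hmem j hj (by omega)) (hmem _ (by omega) hjn) (by omega)
  · rintro l hl ⟨h1, h2⟩
    have : a l ∈ (Finset.Icc 1 n).image z :=
      himage ▸ Finset.mem_image_of_mem a (Finset.mem_range.2 hl)
    obtain ⟨k, hk, hkl⟩ := Finset.mem_image.1 this
    have hk' : k ∈ (Finset.Icc 1 n : Set ℕ) := by exact_mod_cast hk
    rw [hai, ← hkl] at h1
    rw [hai', ← hkl] at h2
    have h3 := (hz.lt_iff_lt (hmem j hj (by omega)) hk').1 h1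
    have h4 := (hz.lt_iff_lt hk' (hmem _ (by omega) hjn)).1 h2
    omega

/-- On `[0,1]`, `|p_n|` exceeds `|p_n(a_n)|` at most by the factor
`exp (n * max_j s_n(j) / H_n(j))`. -/
theorem abs_lejaPoly_le_mul_exp {a : ℕ → ℝ} (hinj : Function.Injective a)
    (ha0 : a 0 = 0) (ha1 : a 1 = 1) {n : ℕ} (hn : 2 ≤ n)
    (hleja : ∀ m ∈ midCandidates a n, |lejaPoly a n m| ≤ |lejaPoly a n (a n)|)
    (ζ : ℕ → ℕ → ℝ) (hmono : StrictMonoOn (ζ n) (Finset.Icc 1 n))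
    (himage : (Finset.Icc 1 n).image (ζ n) = (Finset.range n).image a)
    {x : ℝ} (hx : x ∈ Set.Icc (0 : ℝ) 1) :
    |lejaPoly a n x| ≤ |lejaPoly a n (a n)| *
      Real.exp (n * ⨆ j ∈ Finset.Icc 1 (n - 1), sgap ζ n j / Hfun ζ n j) := by
  have hmem : ∀ k, 1 ≤ k → k ≤ n → k ∈ (Finset.Icc 1 n : Set ℕ) := fun k h h' => by simp [h, h']
  have hex : ∀ i < n, ∃ k, 1 ≤ k ∧ k ≤ n ∧ ζ n k = a i := fun i hi => by
    have : a i ∈ (Finset.Icc 1 n).image (ζ n) :=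
      himage ▸ Finset.mem_image_of_mem a (Finset.mem_range.2 hi)
    simpa [and_assoc] using this
  have h1 : ζ n 1 ≤ x := by
    obtain ⟨k, hk, hkn, hk0⟩ := hex 0 (by omega)
    have := hmono.monotoneOn (hmem 1 le_rfl (by omega)) (hmem k hk hkn) hk
    linarith [hx.1]
  have h2 : x ≤ ζ n n := by
    obtain ⟨k, hk, hkn, hk1⟩ := hex 1 (by omega)
    have := hmono.monotoneOn (hmem k hk hkn) (hmem n (by omega) le_rfl) hkn
    linarith [hx.2]
  obtain ⟨j, hj, hjx, hxj⟩ := exists_consecutive_le_le hn h1 h2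
  obtain ⟨hj1, hjn⟩ := Finset.mem_Icc.1 hj
  have hlt : ζ n j < ζ n (j + 1) :=
    hmono (hmem j hj1 (by omega)) (hmem _ (by omega) (by omega)) (by omega)
  have hxm : |x - (ζ n j + ζ n (j + 1)) / 2| ≤ sgap ζ n j := by
    rw [sgap, abs_le]
    constructor <;> linarith
  have hne : ∀ k ∈ Finset.Icc 1 n, (ζ n j + ζ n (j + 1)) / 2 ≠ ζ n k := by
    intro k hk heq
    have hk' : k ∈ (Finset.Icc 1 n : Set ℕ) := by exact_mod_cast hk
    have h3 := (hmono.lt_iff_lt (hmem j hj1 (by omega)) hk').1 (by linarith)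
    have h4 := (hmono.lt_iff_lt hk' (hmem _ (by omega) (by omega))).1
      (by linarith : ζ n k < ζ n (j + 1))
    omega
  have hn0 : (n : ℝ) ≠ 0 := by positivity
  have hexp : sgap ζ n j * ∑ k ∈ Finset.Icc 1 n, 1 / |(ζ n j + ζ n (j + 1)) / 2 - ζ n k| =
      n * (sgap ζ n j / Hfun ζ n j) := by
    rw [Hfun, div_inv_eq_mul]
    field_simp
  have hprod := prod_abs_sub_le_mul_exp (Finset.Icc 1 n) (ζ n) hxm hne
  rw [← abs_lejaPoly_eq_prod hinj hmono.injOn himage,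
    ← abs_lejaPoly_eq_prod hinj hmono.injOn himage, hexp] at hprod
  refine hprod.trans (mul_le_mul
    (hleja _ (midpoint_mem_midCandidates hmono himage hj1 (by omega))) ?_
    (Real.exp_pos _).le (abs_nonneg _))
  gcongr
  exact le_biSup_finset _ (fun j => sgap ζ n j / Hfun ζ n j) hj

/-- If the fast Leja points `(a_j)` on `[0,1]` (with midpoint
candidates) satisfy Property (★), i.e. `max_{1 ≤ j ≤ n-1} s_n(j)/H_n(j) → 0`,
then they form a pseudo Leja sequence: the ratio
`(sup_{x ∈ [0,1]} |p_n(x)|)/|p_n(a_n)|` grows subexponentially, i.e. its `n`-th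
root tends to `1`. -/
theorem stmt_10
    (a : ℕ → ℝ)
    (hmem : ∀ j, a j ∈ Set.Icc (0 : ℝ) 1)
    (hinj : Function.Injective a)
    (ha0 : a 0 = 0) (ha1 : a 1 = 1)
    (hleja : ∀ n, 2 ≤ n → a n ∈ midCandidates a n ∧
      ∀ m ∈ midCandidates a n, |lejaPoly a n m| ≤ |lejaPoly a n (a n)|)
    (ζ : ℕ → ℕ → ℝ)
    (hζmono : ∀ n, 2 ≤ n → ∀ j k, 1 ≤ j → j < k → k ≤ n → ζ n j < ζ n k)
    (hζimage : ∀ n, 2 ≤ n →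
      (Finset.Icc 1 n).image (ζ n) = (Finset.range n).image a)
    (hstar : Tendsto (fun n : ℕ => ⨆ j ∈ Finset.Icc 1 (n - 1), sgap ζ n j / Hfun ζ n j)
      atTop (nhds 0)) :
    Tendsto (fun n : ℕ =>
        ((⨆ x ∈ Set.Icc (0 : ℝ) 1, |lejaPoly a n x|) / |lejaPoly a n (a n)|) ^ (1 / (n : ℝ)))
      atTop (nhds 1) := by
  have hexp : Tendsto (fun n : ℕ =>
      Real.exp (⨆ j ∈ Finset.Icc 1 (n - 1), sgap ζ n j / Hfun ζ n j)) atTop (nhds 1) := by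
    simpa only [Real.exp_zero, Function.comp_def] using
      (Real.continuous_exp.tendsto 0).comp hstar
  have hbounds : ∀ᶠ n : ℕ in atTop,
      1 ≤ (⨆ x ∈ Set.Icc (0 : ℝ) 1, |lejaPoly a n x|) / |lejaPoly a n (a n)| ∧
      (⨆ x ∈ Set.Icc (0 : ℝ) 1, |lejaPoly a n x|) / |lejaPoly a n (a n)| ≤
        Real.exp (n * ⨆ j ∈ Finset.Icc 1 (n - 1), sgap ζ n j / Hfun ζ n j) := by
    filter_upwards [eventually_ge_atTop 2] with n hn
    have hmono : StrictMonoOn (ζ n) (Finset.Icc 1 n) := by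
      intro j hj k hk hjk
      simp only [Finset.coe_Icc, Set.mem_Icc] at hj hk
      exact hζmono n hn j k hj.1 hjk hk.2
    have hle := fun x (hx : x ∈ Set.Icc (0 : ℝ) 1) => abs_lejaPoly_le_mul_exp hinj ha0 ha1 hn
      (hleja n hn).2 ζ hmono (hζimage n hn) hx
    have hpos : 0 < |lejaPoly a n (a n)| := by
      refine abs_pos.2 (Finset.prod_ne_zero_iff.2 fun j hj => sub_ne_zero.2 fun h => ?_)
      exact (Finset.mem_range.1 hj).ne' (hinj h)
    constructor
    · rw [one_le_div hpos]
      exact le_biSup_of_forall_le (f := fun x => |lejaPoly a n x|) (by positivity) hle (hmem n)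
    · rw [div_le_iff₀' hpos]
      exact Real.iSup_le (fun x => Real.iSup_le (hle x) (by positivity)) (by positivity)
  refine tendsto_of_tendsto_of_tendsto_of_le_of_le' tendsto_const_nhds hexp ?_ ?_
  · filter_upwards [hbounds] with n hn
    exact Real.one_le_rpow hn.1 (by positivity)
  · filter_upwards [hbounds, eventually_gt_atTop 0] with n hn hn0
    have hn0' : (n : ℝ) ≠ 0 := by positivity
    refine (Real.rpow_le_rpow (zero_le_one.trans hn.1) hn.2 (by positivity)).trans_eq ?_
    rw [← Real.exp_mul]
    congr 1
    field_simp
end
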